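/- arXiv:2206.09419 — 5 statements merged into one kernel-verified Lean document; each statement's English description precedes it below -/
import Mathlib

section
/- Fix t ∈ [t₀,T] and z ∈ ℝⁿ, and set y_z(s) = K(s,t)·z and u_z(s) = N(s)⁻¹·B(s)ᵀ·(𝟙_{s<t}·Φ(t,s)ᵀ·z − P(s)·y_z(s)). Then for every continuously differentiable y : [t₀,T] → ℝⁿ and continuous u : [t₀,T] → ℝᵐ satisfying y'(s) = −A(s)·y(s) + B(s)·u(s) for all s ∈ [t₀,T], the reproducing identity holds: ⟨y(t₀), J₀·y_z(t₀)⟩ + ∫_{t₀}^T (⟨M(s)·y(s), y_z(s)⟩ + ⟨N(s)·u(s), u_z(s)⟩) ds = ⟨y(t), z⟩. -/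
open MeasureTheory Matrix Set

section MatrixCalculus

variable {l m n : Type*} {x : ℝ}

theorem HasDerivAt.dotProduct_fun [Fintype n] {f g : ℝ → n → ℝ} {f' g' : n → ℝ}
    (hf : HasDerivAt f f' x) (hg : HasDerivAt g g' x) :
    HasDerivAt (fun s => f s ⬝ᵥ g s) (f' ⬝ᵥ g x + f x ⬝ᵥ g') x := by
  rw [hasDerivAt_pi] at hf hg
  simpa only [dotProduct, ← Finset.sum_add_distrib] using
    HasDerivAt.fun_sum (u := Finset.univ) fun i _ => (hf i).fun_mul (hg i)

theorem HasDerivAt.matrix_mulVec [Fintype n] [Fintype m] {X : ℝ → Matrix m n ℝ}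
    {X' : Matrix m n ℝ} {f : ℝ → n → ℝ} {f' : n → ℝ}
    (hX : ∀ i j, HasDerivAt (fun s => X s i j) (X' i j) x) (hf : HasDerivAt f f' x) :
    HasDerivAt (fun s => X s *ᵥ f s) (X' *ᵥ f x + X x *ᵥ f') x :=
  hasDerivAt_pi.2 fun i => (hasDerivAt_pi.2 (hX i)).dotProduct_fun hf

theorem hasDerivAt_matrix_mul_apply [Fintype m] {X : ℝ → Matrix l m ℝ} {X' : Matrix l m ℝ}
    {Y : ℝ → Matrix m n ℝ} {Y' : Matrix m n ℝ}
    (hX : ∀ i j, HasDerivAt (fun s => X s i j) (X' i j) x)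
    (hY : ∀ i j, HasDerivAt (fun s => Y s i j) (Y' i j) x) (i : l) (j : n) :
    HasDerivAt (fun s => (X s * Y s) i j) ((X' * Y x + X x * Y') i j) x :=
  (hasDerivAt_pi.2 (hX i)).dotProduct_fun (hasDerivAt_pi.2 fun k => hY k j)

theorem continuousOn_matrix_of_hasDerivAt {S : Set ℝ} {X X' : ℝ → Matrix m n ℝ}
    (hX : ∀ s ∈ S, ∀ i j, HasDerivAt (fun τ => X τ i j) (X' s i j) s) : ContinuousOn X S :=
  continuousOn_pi.2 fun i => continuousOn_pi.2 fun j s hs =>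
    (hX s hs i j).continuousAt.continuousWithinAt

variable {S : Set ℝ}

theorem ContinuousOn.matrix_mul [Fintype m] {X : ℝ → Matrix l m ℝ} {Y : ℝ → Matrix m n ℝ}
    (hX : ContinuousOn X S) (hY : ContinuousOn Y S) : ContinuousOn (fun s => X s * Y s) S := by
  rw [continuousOn_iff_continuous_domRestrict] at *
  exact Continuous.matrix_mul hX hY

theorem ContinuousOn.matrix_mulVec [Fintype m] {X : ℝ → Matrix l m ℝ} {f : ℝ → m → ℝ}
    (hX : ContinuousOn X S) (hf : ContinuousOn f S) : ContinuousOn (fun s => X s *ᵥ f s) S := by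
  rw [continuousOn_iff_continuous_domRestrict] at *
  exact Continuous.matrix_mulVec hX hf

theorem ContinuousOn.dotProduct_fun [Fintype m] {f g : ℝ → m → ℝ}
    (hf : ContinuousOn f S) (hg : ContinuousOn g S) : ContinuousOn (fun s => f s ⬝ᵥ g s) S := by
  rw [continuousOn_iff_continuous_domRestrict] at *
  exact Continuous.dotProduct hf hg

theorem ContinuousOn.matrix_transpose {X : ℝ → Matrix l m ℝ}
    (hX : ContinuousOn X S) : ContinuousOn (fun s => (X s)ᵀ) S := by
  rw [continuousOn_iff_continuous_domRestrict] at *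
  exact Continuous.matrix_transpose hX

theorem ContinuousOn.matrix_inv [Fintype m] [DecidableEq m] {X : ℝ → Matrix m m ℝ}
    (hX : ContinuousOn X S) (h : ∀ s ∈ S, IsUnit (X s)) : ContinuousOn (fun s => (X s)⁻¹) S := by
  have hdet : ∀ s ∈ S, (X s).det ≠ 0 := fun s hs =>
    ((X s).isUnit_iff_isUnit_det.1 (h s hs)).ne_zero
  simp only [Matrix.inv_def, Ring.inverse_eq_inv']
  have h₁ : ContinuousOn (fun s => (X s).det) S := by
    rw [continuousOn_iff_continuous_domRestrict] at *
    exact Continuous.matrix_det hX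
  have h₂ : ContinuousOn (fun s => (X s).adjugate) S := by
    rw [continuousOn_iff_continuous_domRestrict] at *
    exact Continuous.matrix_adjugate hX
  exact (h₁.inv₀ hdet).smul h₂

end MatrixCalculus

theorem eq_of_hasDerivAt_zero_on_Icc {t₀ T : ℝ} {f : ℝ → ℝ}
    (hf : ∀ s ∈ Icc t₀ T, HasDerivAt f 0 s) {a b : ℝ} (ha : a ∈ Icc t₀ T) (hb : b ∈ Icc t₀ T) :
    f a = f b := by
  have h := constant_of_has_deriv_right_zero
    (fun s hs => (hf s hs).continuousAt.continuousWithinAt)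
    (fun s hs => (hf s (Ico_subset_Icc_self hs)).hasDerivWithinAt)
  rw [h a ha, h b hb]

section LinearQuadratic

variable {n : Type*} [Fintype n] {t₀ T : ℝ}

theorem evolution_mul_evolution [DecidableEq n] {G : ℝ → Matrix n n ℝ} {Φ : ℝ → ℝ → Matrix n n ℝ}
    (hΦ0 : ∀ s ∈ Icc t₀ T, Φ s s = 1)
    (hΦt : ∀ s ∈ Icc t₀ T, ∀ t ∈ Icc t₀ T, ∀ i j,
      HasDerivAt (fun τ => Φ τ s i j) ((-(G t * Φ t s)) i j) t)
    (hΦs : ∀ t ∈ Icc t₀ T, ∀ s ∈ Icc t₀ T, ∀ i j,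
      HasDerivAt (fun σ => Φ t σ i j) ((Φ t s * G s) i j) s)
    {s r τ : ℝ} (hs : s ∈ Icc t₀ T) (hr : r ∈ Icc t₀ T) (hτ : τ ∈ Icc t₀ T) :
    Φ s r * Φ r τ = Φ s τ := by
  have key : Φ s r * Φ r τ = Φ s s * Φ s τ := by
    ext i j
    refine eq_of_hasDerivAt_zero_on_Icc (f := fun σ => (Φ s σ * Φ σ τ) i j) (fun σ hσ => ?_) hr hs
    convert hasDerivAt_matrix_mul_apply (hΦs s hs σ hσ) (hΦt τ hτ σ hσ) i j using 1
    simp [Matrix.mul_assoc]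
  rw [key, hΦ0 s hs, Matrix.one_mul]

theorem riccati_transpose_eq [DecidableEq n] {A F M P : ℝ → Matrix n n ℝ} {Φ : ℝ → ℝ → Matrix n n ℝ}
    (hF : ∀ s ∈ Icc t₀ T, (F s)ᵀ = F s) (hM : ∀ s ∈ Icc t₀ T, (M s)ᵀ = M s)
    (hP : ∀ s ∈ Icc t₀ T, ∀ i j, HasDerivAt (fun τ => P τ i j)
      ((P s * A s + (A s)ᵀ * P s + P s * F s * P s - M s) i j) s)
    (hPT : P T = 0) (hΦ0 : ∀ s ∈ Icc t₀ T, Φ s s = 1)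
    (hΦt : ∀ s ∈ Icc t₀ T, ∀ t ∈ Icc t₀ T, ∀ i j,
      HasDerivAt (fun τ => Φ τ s i j) ((-((A t + F t * P t) * Φ t s)) i j) t)
    {s : ℝ} (hs : s ∈ Icc t₀ T) : (P s)ᵀ = P s := by
  have hT : T ∈ Icc t₀ T := ⟨hs.1.trans hs.2, le_rfl⟩
  have key : (Φ s s)ᵀ * ((P s - (P s)ᵀ) * Φ s s) = (Φ T s)ᵀ * ((P T - (P T)ᵀ) * Φ T s) := by
    ext i j
    refine eq_of_hasDerivAt_zero_on_Icc
      (f := fun σ => ((Φ σ s)ᵀ * ((P σ - (P σ)ᵀ) * Φ σ s)) i j) (fun σ hσ => ?_) hs hT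
    have hD : ∀ i j, HasDerivAt (fun τ => (P τ - (P τ)ᵀ) i j)
        (((P σ * A σ + (A σ)ᵀ * P σ + P σ * F σ * P σ - M σ)
          - (P σ * A σ + (A σ)ᵀ * P σ + P σ * F σ * P σ - M σ)ᵀ) i j) σ :=
      fun i j => (hP σ hσ i j).sub (hP σ hσ j i)
    have hΦT : ∀ i j, HasDerivAt (fun τ => (Φ τ s)ᵀ i j)
        ((-((A σ + F σ * P σ) * Φ σ s))ᵀ i j) σ := fun i j => hΦt s hs σ hσ j i
    refine (hasDerivAt_matrix_mul_apply hΦT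
      (hasDerivAt_matrix_mul_apply hD (hΦt s hs σ hσ)) i j).congr_deriv
        (congrFun (congrFun (?_ : _ = (0 : Matrix n n ℝ)) i) j)
    simp only [transpose_sub, transpose_add, transpose_mul, transpose_neg, transpose_transpose,
      hF σ hσ, hM σ hσ]
    noncomm_ring
  rw [hPT, hΦ0 s hs] at key
  simpa [sub_eq_zero, eq_comm] using key

/-- The costate `c • q - P v` of the closed-loop state `v` solves the adjoint equation. -/
theorem hasDerivAt_costate {A F M : Matrix n n ℝ} {P : ℝ → Matrix n n ℝ} {s c : ℝ}
    {q v : ℝ → n → ℝ} (hF : Fᵀ = F) (hPs : (P s)ᵀ = P s)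
    (hP : ∀ i j, HasDerivAt (fun τ => P τ i j)
      ((P s * A + Aᵀ * P s + P s * F * P s - M) i j) s)
    (hq : HasDerivAt q ((A + F * P s)ᵀ *ᵥ q s) s)
    (hv : HasDerivAt v (-((A + F * P s) *ᵥ v s) + c • (F *ᵥ q s)) s) :
    HasDerivAt (fun τ => c • q τ - P τ *ᵥ v τ) (Aᵀ *ᵥ (c • q s - P s *ᵥ v s) + M *ᵥ v s) s := by
  refine ((hq.const_smul c).sub (HasDerivAt.matrix_mulVec hP hv)).congr_deriv ?_
  simp only [transpose_add, transpose_mul, hF, hPs, add_mulVec, sub_mulVec, mulVec_add, mulVec_sub,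
    mulVec_neg, mulVec_smul, ← mulVec_mulVec]
  module

theorem integral_trajectory_dotProduct {k : Type*} [Fintype k] [DecidableEq k]
    {A M P : ℝ → Matrix n n ℝ} {B : ℝ → Matrix n k ℝ} {N : ℝ → Matrix k k ℝ} {a b c : ℝ}
    (hab : a ≤ b) (hM : ContinuousOn M (Icc a b)) (hB : ContinuousOn B (Icc a b))
    (hN : ContinuousOn N (Icc a b))
    (hMs : ∀ s ∈ Icc a b, (M s)ᵀ = M s) (hNpd : ∀ s ∈ Icc a b, (N s).PosDef)
    (hPs : ∀ s ∈ Icc a b, (P s)ᵀ = P s)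
    (hP : ∀ s ∈ Icc a b, ∀ i j, HasDerivAt (fun τ => P τ i j)
      ((P s * A s + (A s)ᵀ * P s + P s * (B s * (N s)⁻¹ * (B s)ᵀ) * P s - M s) i j) s)
    {q v y : ℝ → n → ℝ} {u : ℝ → k → ℝ}
    (hq : ∀ s ∈ Icc a b, HasDerivAt q ((A s + B s * (N s)⁻¹ * (B s)ᵀ * P s)ᵀ *ᵥ q s) s)
    (hvc : ContinuousOn v (Icc a b))
    (hv : ∀ s ∈ Ioo a b, HasDerivAt v (-((A s + B s * (N s)⁻¹ * (B s)ᵀ * P s) *ᵥ v s)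
      + c • ((B s * (N s)⁻¹ * (B s)ᵀ) *ᵥ q s)) s)
    (hu : ContinuousOn u (Icc a b))
    (hy : ∀ s ∈ Icc a b, HasDerivAt y (-(A s *ᵥ y s) + B s *ᵥ u s) s) :
    IntervalIntegrable (fun s => (M s *ᵥ y s) ⬝ᵥ v s
      + (N s *ᵥ u s) ⬝ᵥ ((N s)⁻¹ *ᵥ ((B s)ᵀ *ᵥ (c • q s - P s *ᵥ v s)))) volume a b ∧
    ∫ s in a..b, ((M s *ᵥ y s) ⬝ᵥ v s
      + (N s *ᵥ u s) ⬝ᵥ ((N s)⁻¹ *ᵥ ((B s)ᵀ *ᵥ (c • q s - P s *ᵥ v s))))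
      = y b ⬝ᵥ (c • q b - P b *ᵥ v b) - y a ⬝ᵥ (c • q a - P a *ᵥ v a) := by
  have hyc : ContinuousOn y (Icc a b) := fun s hs => (hy s hs).continuousAt.continuousWithinAt
  have hqc : ContinuousOn q (Icc a b) := fun s hs => (hq s hs).continuousAt.continuousWithinAt
  have hPc : ContinuousOn P (Icc a b) := continuousOn_matrix_of_hasDerivAt hP
  have hpc : ContinuousOn (fun s => c • q s - P s *ᵥ v s) (Icc a b) :=
    (hqc.const_smul c).sub (hPc.matrix_mulVec hvc)
  have hNu : ∀ s ∈ Icc a b, IsUnit (N s) := fun s hs => (hNpd s hs).isUnit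
  have hint : IntervalIntegrable (fun s => (M s *ᵥ y s) ⬝ᵥ v s
      + (N s *ᵥ u s) ⬝ᵥ ((N s)⁻¹ *ᵥ ((B s)ᵀ *ᵥ (c • q s - P s *ᵥ v s)))) volume a b :=
    ContinuousOn.intervalIntegrable_of_Icc hab <|
      ((hM.matrix_mulVec hyc).dotProduct_fun hvc).add ((hN.matrix_mulVec hu).dotProduct_fun
        ((hN.matrix_inv hNu).matrix_mulVec (hB.matrix_transpose.matrix_mulVec hpc)))
  refine ⟨hint, intervalIntegral.integral_eq_sub_of_hasDerivAt_of_le hab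
    (hyc.dotProduct_fun hpc) (fun s hs => ?_) hint⟩
  have hs' := Ioo_subset_Icc_self hs
  have hNs : (N s)ᵀ = N s := (hNpd s hs').isHermitian
  have hFs : (B s * (N s)⁻¹ * (B s)ᵀ)ᵀ = B s * (N s)⁻¹ * (B s)ᵀ := by
    simp [transpose_nonsing_inv, hNs, Matrix.mul_assoc]
  refine ((hy s hs').dotProduct_fun
    (hasDerivAt_costate hFs (hPs s hs') (hP s hs') (hq s hs') (hv s hs))).congr_deriv ?_
  generalize c • q s - P s *ᵥ v s = p
  have h₁ : (N s *ᵥ u s) ⬝ᵥ ((N s)⁻¹ *ᵥ ((B s)ᵀ *ᵥ p)) = (B s *ᵥ u s) ⬝ᵥ p := by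
    rw [dotProduct_mulVec, ← mulVec_transpose, transpose_nonsing_inv, hNs, mulVec_mulVec,
      nonsing_inv_mul _ ((N s).isUnit_iff_isUnit_det.1 (hNu s hs')), one_mulVec,
      dotProduct_mulVec, vecMul_transpose]
  have h₂ : (M s *ᵥ y s) ⬝ᵥ v s = y s ⬝ᵥ (M s *ᵥ v s) := by
    rw [dotProduct_mulVec, ← mulVec_transpose, hMs s hs']
  have h₃ : y s ⬝ᵥ ((A s)ᵀ *ᵥ p) = (A s *ᵥ y s) ⬝ᵥ p := by
    rw [dotProduct_mulVec, vecMul_transpose]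
  rw [h₁, h₂, add_dotProduct, neg_dotProduct, dotProduct_add, h₃]
  ring

end LinearQuadratic

/-- Reproducing identity of the LQR kernel: for any controlled
trajectory `(y,u)` of the linear system,
`⟨y(t₀), J₀ y_z(t₀)⟩ + ∫ (⟨M y, y_z⟩ + ⟨N u, u_z⟩) = ⟨y(t), z⟩`. -/
theorem stmt_1
    {n m : ℕ} {t₀ T : ℝ} (htT : t₀ < T)
    (A M : ℝ → Matrix (Fin n) (Fin n) ℝ)
    (B : ℝ → Matrix (Fin n) (Fin m) ℝ)
    (N : ℝ → Matrix (Fin m) (Fin m) ℝ)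
    (hA : ContinuousOn A (Icc t₀ T)) (hM : ContinuousOn M (Icc t₀ T))
    (hB : ContinuousOn B (Icc t₀ T)) (hN : ContinuousOn N (Icc t₀ T))
    (hMpsd : ∀ t ∈ Icc t₀ T, (M t).PosSemidef)
    (hNpd : ∀ t ∈ Icc t₀ T, (N t).PosDef)
    (P : ℝ → Matrix (Fin n) (Fin n) ℝ)
    (hP : ∀ t ∈ Icc t₀ T, ∀ i j, HasDerivAt (fun τ => P τ i j)
      ((P t * A t + (A t)ᵀ * P t + P t * B t * (N t)⁻¹ * (B t)ᵀ * P t - M t) i j) t)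
    (hPT : P T = 0)
    (Φ : ℝ → ℝ → Matrix (Fin n) (Fin n) ℝ)
    (hΦ0 : ∀ s ∈ Icc t₀ T, Φ s s = 1)
    (hΦt : ∀ s ∈ Icc t₀ T, ∀ t ∈ Icc t₀ T, ∀ i j,
      HasDerivAt (fun τ => Φ τ s i j)
        ((-((A t + B t * (N t)⁻¹ * (B t)ᵀ * P t) * Φ t s)) i j) t)
    (hΦs : ∀ t ∈ Icc t₀ T, ∀ s ∈ Icc t₀ T, ∀ i j,
      HasDerivAt (fun σ => Φ t σ i j)
        ((Φ t s * (A s + B s * (N s)⁻¹ * (B s)ᵀ * P s)) i j) s)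
    (J₀ : Matrix (Fin n) (Fin n) ℝ)
    (hJ₀ : J₀.PosSemidef) (hJP : IsUnit (J₀ + P t₀))
    (K : ℝ → ℝ → Matrix (Fin n) (Fin n) ℝ)
    (hK : ∀ s, ∀ t, ∀ i j,
      K s t i j = (Φ s t₀ * (J₀ + P t₀)⁻¹ * (Φ t t₀)ᵀ) i j
        + ∫ τ in t₀..min s t, (Φ s τ * B τ * (N τ)⁻¹ * (B τ)ᵀ * (Φ t τ)ᵀ) i j)
    (t : ℝ) (ht : t ∈ Icc t₀ T) (z : Fin n → ℝ)
    (y_z : ℝ → Fin n → ℝ) (u_z : ℝ → Fin m → ℝ)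
    (hy_z : ∀ s, y_z s = K s t *ᵥ z)
    (hu_z : ∀ s, u_z s = (N s)⁻¹ *ᵥ ((B s)ᵀ *ᵥ
      ((if s < t then (1:ℝ) else 0) • ((Φ t s)ᵀ *ᵥ z) - P s *ᵥ y_z s))) :
    ∀ (y : ℝ → Fin n → ℝ) (u : ℝ → Fin m → ℝ),
      ContinuousOn u (Icc t₀ T) →
      (∀ s ∈ Icc t₀ T, HasDerivAt y (-(A s *ᵥ y s) + B s *ᵥ u s) s) →
      (y t₀) ⬝ᵥ (J₀ *ᵥ y_z t₀)
        + ∫ s in t₀..T, ((M s *ᵥ y s) ⬝ᵥ y_z s + (N s *ᵥ u s) ⬝ᵥ u_z s)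
        = (y t) ⬝ᵥ z := by
  intro y u hu hy
  have ht₀ : t₀ ∈ Icc t₀ T := left_mem_Icc.2 htT.le
  have hMs : ∀ s ∈ Icc t₀ T, (M s)ᵀ = M s := fun s hs => (hMpsd s hs).isHermitian
  have hNs : ∀ s ∈ Icc t₀ T, (N s)ᵀ = N s := fun s hs => (hNpd s hs).isHermitian
  set F : ℝ → Matrix (Fin n) (Fin n) ℝ := fun s => B s * (N s)⁻¹ * (B s)ᵀ with hFdef
  set G : ℝ → Matrix (Fin n) (Fin n) ℝ := fun s => A s + F s * P s
  have hFs : ∀ s ∈ Icc t₀ T, (F s)ᵀ = F s := fun s hs => by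
    simp [hFdef, transpose_nonsing_inv, hNs s hs, Matrix.mul_assoc]
  have hP' : ∀ s ∈ Icc t₀ T, ∀ i j, HasDerivAt (fun τ => P τ i j)
      ((P s * A s + (A s)ᵀ * P s + P s * F s * P s - M s) i j) s := fun s hs i j => by
    simpa only [hFdef, Matrix.mul_assoc] using hP s hs i j
  have hPs : ∀ s ∈ Icc t₀ T, (P s)ᵀ = P s := fun s hs =>
    riccati_transpose_eq hFs hMs hP' hPT hΦ0 hΦt hs
  have hFc : ContinuousOn F (Icc t₀ T) :=
    (hB.matrix_mul (hN.matrix_inv fun s hs => (hNpd s hs).isUnit)).matrix_mul hB.matrix_transpose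
  have hΦ₁c : ContinuousOn (fun s => Φ s t₀) (Icc t₀ T) :=
    continuousOn_matrix_of_hasDerivAt (hΦt t₀ ht₀)
  have hΦ₂c : ∀ r ∈ Icc t₀ T, ContinuousOn (Φ r) (Icc t₀ T) := fun r hr =>
    continuousOn_matrix_of_hasDerivAt (hΦs r hr)
  have hq : ∀ s ∈ Icc t₀ T, HasDerivAt (fun s => (Φ t s)ᵀ *ᵥ z) ((G s)ᵀ *ᵥ ((Φ t s)ᵀ *ᵥ z)) s := by
    intro s hs
    have hT : ∀ i j, HasDerivAt (fun τ => (Φ t τ)ᵀ i j) ((Φ t s * G s)ᵀ i j) s :=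
      fun i j => hΦs t ht s hs j i
    refine (HasDerivAt.matrix_mulVec hT (hasDerivAt_const s z)).congr_deriv ?_
    simp [transpose_mul, mulVec_mulVec]
  set X : ℝ → Matrix (Fin n) (Fin n) ℝ := fun τ => Φ t₀ τ * (F τ * (Φ t τ)ᵀ) with hXdef
  have hXc : ContinuousOn X (Icc t₀ T) :=
    (hΦ₂c t₀ ht₀).matrix_mul (hFc.matrix_mul (hΦ₂c t ht).matrix_transpose)
  have hXij : ∀ i j, ContinuousOn (fun τ => X τ i j) (Icc t₀ T) := fun i j =>
    continuousOn_pi.1 (continuousOn_pi.1 hXc i) j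
  have hXint : ∀ i j, ∀ s ∈ Icc t₀ T, IntervalIntegrable (fun τ => X τ i j) volume t₀ s :=
    fun i j s hs => ((hXij i j).mono (Icc_subset_Icc_right hs.2)).intervalIntegrable_of_Icc hs.1
  have hmin : ∀ s ∈ Icc t₀ T, min s t ∈ Icc t₀ T := fun s hs =>
    ⟨le_min hs.1 ht.1, (min_le_left _ _).trans hs.2⟩
  let W : ℝ → Matrix (Fin n) (Fin n) ℝ := fun s => of fun i j => ∫ τ in t₀..min s t, X τ i j
  have hWc : ContinuousOn W (Icc t₀ T) := by
    refine continuousOn_pi.2 fun i => continuousOn_pi.2 fun j => ?_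
    have h := intervalIntegral.continuousOn_primitive_interval'
      (hXint i j T (right_mem_Icc.2 htT.le)) left_mem_uIcc
    rw [uIcc_of_le htT.le] at h
    exact h.comp (continuous_id.min continuous_const).continuousOn hmin
  set C : Matrix (Fin n) (Fin n) ℝ := (J₀ + P t₀)⁻¹ * (Φ t t₀)ᵀ with hCdef
  have hKW : ∀ s ∈ Icc t₀ T, K s t = Φ s t₀ * (C + W s) := by
    intro s hs
    have hfac : ∀ τ ∈ Icc t₀ T, Φ s τ * B τ * (N τ)⁻¹ * (B τ)ᵀ * (Φ t τ)ᵀ = Φ s t₀ * X τ := by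
      intro τ hτ
      rw [hXdef, ← Matrix.mul_assoc,
        evolution_mul_evolution hΦ0 hΦt hΦs hs ht₀ hτ]
      simp only [hFdef, Matrix.mul_assoc]
    ext i j
    rw [hK, Matrix.mul_add, Matrix.add_apply, hCdef, Matrix.mul_assoc]
    congr 1
    rw [Matrix.mul_apply]
    simp only [W, of_apply, ← intervalIntegral.integral_const_mul]
    rw [← intervalIntegral.integral_finsetSum fun k _ =>
      (hXint k j _ (hmin s hs)).const_mul _]
    refine intervalIntegral.integral_congr fun τ hτ => ?_
    rw [uIcc_of_le (hmin s hs).1] at hτ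
    rw [hfac τ ⟨hτ.1, hτ.2.trans (hmin s hs).2⟩, Matrix.mul_apply]
  have hyW : ∀ s ∈ Icc t₀ T, y_z s = Φ s t₀ *ᵥ ((C + W s) *ᵥ z) := fun s hs => by
    rw [hy_z, hKW s hs, mulVec_mulVec]
  have hyc : ContinuousOn y_z (Icc t₀ T) :=
    (hΦ₁c.matrix_mulVec ((continuousOn_const.add hWc).matrix_mulVec continuousOn_const)).congr hyW
  have hyd : ∀ s ∈ Ioo t₀ T, ∀ c : ℝ,
      (∀ i j, HasDerivAt (fun σ => W σ i j) ((c • X s) i j) s) →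
      HasDerivAt y_z (-(G s *ᵥ y_z s) + c • (F s *ᵥ ((Φ t s)ᵀ *ᵥ z))) s := by
    intro s hs c hW
    have hs' := Ioo_subset_Icc_self hs
    have hCW : ∀ i j, HasDerivAt (fun σ => (C + W σ) i j) ((c • X s) i j) s :=
      fun i j => (hW i j).const_add (C i j)
    have h := HasDerivAt.matrix_mulVec (hΦt t₀ ht₀ s hs')
      (HasDerivAt.matrix_mulVec hCW (hasDerivAt_const s z))
    refine (h.congr_of_eventuallyEq ?_).congr_deriv ?_
    · filter_upwards [Icc_mem_nhds hs.1 hs.2] with σ hσ using hyW σ hσ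
    · have hX : Φ s t₀ *ᵥ (X s *ᵥ z) = F s *ᵥ ((Φ t s)ᵀ *ᵥ z) := by
        rw [mulVec_mulVec, hXdef, ← Matrix.mul_assoc,
          evolution_mul_evolution hΦ0 hΦt hΦs hs' ht₀ hs', hΦ0 s hs', Matrix.one_mul,
          mulVec_mulVec]
      rw [hyW s hs', mulVec_zero, add_zero, neg_mulVec, ← mulVec_mulVec, smul_mulVec, mulVec_smul,
        hX]
  have hsub₁ : Icc t₀ t ⊆ Icc t₀ T := Icc_subset_Icc_right ht.2
  have hsub₂ : Icc t T ⊆ Icc t₀ T := Icc_subset_Icc_left ht.1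
  have hyd₁ : ∀ s ∈ Ioo t₀ t,
      HasDerivAt y_z (-(G s *ᵥ y_z s) + (1 : ℝ) • (F s *ᵥ ((Φ t s)ᵀ *ᵥ z))) s := by
    intro s hs
    have hs' : s ∈ Ioo t₀ T := ⟨hs.1, hs.2.trans_le ht.2⟩
    refine hyd s hs' 1 fun i j => ?_
    have hc : ContinuousOn (fun τ => X τ i j) (Ioo t₀ T) := (hXij i j).mono Ioo_subset_Icc_self
    rw [one_smul]
    refine (intervalIntegral.integral_hasDerivAt_right (hXint i j s (Ioo_subset_Icc_self hs'))
      (hc.stronglyMeasurableAtFilter isOpen_Ioo s hs')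
      (hc.continuousAt (isOpen_Ioo.mem_nhds hs'))).congr_of_eventuallyEq ?_
    filter_upwards [Iio_mem_nhds hs.2] with σ hσ
    simp only [W, of_apply, min_eq_left (mem_Iio.1 hσ).le]
  have hyd₂ : ∀ s ∈ Ioo t T,
      HasDerivAt y_z (-(G s *ᵥ y_z s) + (0 : ℝ) • (F s *ᵥ ((Φ t s)ᵀ *ᵥ z))) s := by
    intro s hs
    refine hyd s ⟨ht.1.trans_lt hs.1, hs.2⟩ 0 fun i j => ?_
    rw [zero_smul]
    refine (hasDerivAt_const s (∫ τ in t₀..t, X τ i j)).congr_of_eventuallyEq ?_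
    filter_upwards [Ioi_mem_nhds hs.1] with σ hσ
    simp only [W, of_apply, min_eq_right (mem_Ioi.1 hσ).le]
  obtain ⟨hi₁, he₁⟩ := integral_trajectory_dotProduct ht.1 (hM.mono hsub₁) (hB.mono hsub₁)
    (hN.mono hsub₁) (fun s hs => hMs s (hsub₁ hs)) (fun s hs => hNpd s (hsub₁ hs))
    (fun s hs => hPs s (hsub₁ hs)) (fun s hs => hP' s (hsub₁ hs)) (fun s hs => hq s (hsub₁ hs))
    (hyc.mono hsub₁) hyd₁ (hu.mono hsub₁) (fun s hs => hy s (hsub₁ hs))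
  obtain ⟨hi₂, he₂⟩ := integral_trajectory_dotProduct ht.2 (hM.mono hsub₂) (hB.mono hsub₂)
    (hN.mono hsub₂) (fun s hs => hMs s (hsub₂ hs)) (fun s hs => hNpd s (hsub₂ hs))
    (fun s hs => hPs s (hsub₂ hs)) (fun s hs => hP' s (hsub₂ hs)) (fun s hs => hq s (hsub₂ hs))
    (hyc.mono hsub₂) hyd₂ (hu.mono hsub₂) (fun s hs => hy s (hsub₂ hs))
  have hg₁ : EqOn (fun s => (M s *ᵥ y s) ⬝ᵥ y_z s + (N s *ᵥ u s) ⬝ᵥ ((N s)⁻¹ *ᵥ ((B s)ᵀ *ᵥ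
      ((1 : ℝ) • ((Φ t s)ᵀ *ᵥ z) - P s *ᵥ y_z s))))
      (fun s => (M s *ᵥ y s) ⬝ᵥ y_z s + (N s *ᵥ u s) ⬝ᵥ u_z s) (uIoo t₀ t) := fun s hs => by
    rw [uIoo_of_le ht.1] at hs
    simp only [hu_z, if_pos hs.2]
  have hg₂ : EqOn (fun s => (M s *ᵥ y s) ⬝ᵥ y_z s + (N s *ᵥ u s) ⬝ᵥ ((N s)⁻¹ *ᵥ ((B s)ᵀ *ᵥ
      ((0 : ℝ) • ((Φ t s)ᵀ *ᵥ z) - P s *ᵥ y_z s))))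
      (fun s => (M s *ᵥ y s) ⬝ᵥ y_z s + (N s *ᵥ u s) ⬝ᵥ u_z s) (uIoo t T) := fun s hs => by
    rw [uIoo_of_le ht.2] at hs
    simp only [hu_z, if_neg hs.1.not_gt]
  rw [← intervalIntegral.integral_add_adjacent_intervals (hi₁.congr_uIoo hg₁) (hi₂.congr_uIoo hg₂),
    ← intervalIntegral.integral_congr_uIoo hg₁, ← intervalIntegral.integral_congr_uIoo hg₂,
    he₁, he₂, hPT, hΦ0 t ht]
  have hinit : J₀ *ᵥ y_z t₀ = (Φ t t₀)ᵀ *ᵥ z - P t₀ *ᵥ y_z t₀ := by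
    have hW₀ : W t₀ = 0 := by
      ext i j
      simp [W, min_eq_left ht.1]
    rw [eq_sub_iff_add_eq, ← add_mulVec, hyW t₀ ht₀, hW₀, hΦ0 t₀ ht₀, add_zero, one_mulVec,
      mulVec_mulVec, hCdef, ← Matrix.mul_assoc,
      mul_nonsing_inv _ ((Matrix.isUnit_iff_isUnit_det _).1 hJP), Matrix.one_mul]
  rw [hinit]
  simp only [transpose_one, one_mulVec, zero_mulVec, one_smul, zero_smul, dotProduct_sub,
    dotProduct_zero]
  ring
end

section
/- Fix t ∈ [t₀,T] and z ∈ ℝⁿ, and set ζ(s) = Φ_A(s,t₀)·(J₀ + π(t₀))⁻¹·Φ_A(t,t₀)ᵀ·z. Then for every differentiable y : [t₀,T] → ℝⁿ with y'(s) = −A(s)·y(s) for all s ∈ [t₀,T], one has ⟨ζ(t₀), J₀·y(t₀)⟩ + ∫_{t₀}^T ⟨M(s)·ζ(s), y(s)⟩ ds = ⟨y(t), z⟩; that is, ζ represents evaluation at t on the subspace of uncontrolled trajectories, and hence is the projection of K(·,t)z onto that subspace. -/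
open MeasureTheory Matrix Set

section Derivatives

variable {n : Type*} [Fintype n]

theorem hasDerivAt_dotProduct {u v : ℝ → n → ℝ} {u' v' : n → ℝ} {s : ℝ}
    (hu : HasDerivAt u u' s) (hv : HasDerivAt v v' s) :
    HasDerivAt (fun τ => u τ ⬝ᵥ v τ) (u' ⬝ᵥ v s + u s ⬝ᵥ v') s := by
  simp only [dotProduct, ← Finset.sum_add_distrib]
  exact HasDerivAt.fun_sum fun i _ => (hasDerivAt_pi.1 hu i).mul (hasDerivAt_pi.1 hv i)

theorem hasDerivAt_mulVec {m : Type*} [Fintype m] {P : ℝ → Matrix m n ℝ} {P' : Matrix m n ℝ}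
    {v : ℝ → n → ℝ} {v' : n → ℝ} {s : ℝ} (hP : ∀ i j, HasDerivAt (fun τ => P τ i j) (P' i j) s)
    (hv : HasDerivAt v v' s) :
    HasDerivAt (fun τ => P τ *ᵥ v τ) (P' *ᵥ v s + P s *ᵥ v') s :=
  hasDerivAt_pi.2 fun i => hasDerivAt_dotProduct (hasDerivAt_pi.2 (hP i)) hv

theorem eq_of_hasDerivAt_zero {f : ℝ → ℝ} {a b : ℝ} (hab : a ≤ b)
    (hf : ∀ s ∈ Icc a b, HasDerivAt f 0 s) : f a = f b :=
  (constant_of_has_deriv_right_zero (fun s hs => (hf s hs).continuousAt.continuousWithinAt)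
    (fun s hs => (hf s (Ico_subset_Icc_self hs)).hasDerivWithinAt) b (right_mem_Icc.2 hab)).symm

/-- Along two solutions of `w' = -A w`, a solution `P` of the Lyapunov equation
`P' = P A + Aᵀ P - N` yields a bilinear pairing with derivative `-⟨u, N v⟩`. -/
theorem hasDerivAt_lyapunov_pairing {P : ℝ → Matrix n n ℝ} {A N : Matrix n n ℝ}
    {u v : ℝ → n → ℝ} {s : ℝ}
    (hP : ∀ i j, HasDerivAt (fun τ => P τ i j) ((P s * A + Aᵀ * P s - N) i j) s)
    (hu : HasDerivAt u (-(A *ᵥ u s)) s) (hv : HasDerivAt v (-(A *ᵥ v s)) s) :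
    HasDerivAt (fun τ => u τ ⬝ᵥ (P τ *ᵥ v τ)) (-(u s ⬝ᵥ (N *ᵥ v s))) s := by
  convert hasDerivAt_dotProduct hu (hasDerivAt_mulVec hP hv) using 1
  have h : u s ⬝ᵥ (Aᵀ *ᵥ (P s *ᵥ v s)) = (A *ᵥ u s) ⬝ᵥ (P s *ᵥ v s) := by
    rw [dotProduct_mulVec, vecMul_transpose]
  simp only [sub_mulVec, add_mulVec, mulVec_neg, ← mulVec_mulVec, dotProduct_add, dotProduct_sub,
    dotProduct_neg, neg_dotProduct, h]
  ring

end Derivatives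

theorem transpose_eq_of_posSemidef {n : Type*} {P : Matrix n n ℝ} (hP : P.PosSemidef) :
    Pᵀ = P :=
  (conjTranspose_eq_transpose_of_trivial P).symm.trans hP.isHermitian

/-- The function `ζ(s) = Φ_A(s,t₀)(J₀+π(t₀))⁻¹Φ_A(t,t₀)ᵀ z`
represents evaluation at `t` on the subspace of uncontrolled trajectories:
for every `y` with `y' = −A y`, `⟨ζ(t₀), J₀ y(t₀)⟩ + ∫ ⟨M ζ, y⟩ = ⟨y(t), z⟩`. -/
theorem stmt_4
    {n : ℕ} {t₀ T : ℝ} (htT : t₀ < T)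
    (A M : ℝ → Matrix (Fin n) (Fin n) ℝ)
    (hA : ContinuousOn A (Icc t₀ T)) (hM : ContinuousOn M (Icc t₀ T))
    (hMpsd : ∀ t ∈ Icc t₀ T, (M t).PosSemidef)
    (ΦA : ℝ → ℝ → Matrix (Fin n) (Fin n) ℝ)
    (hΦ0 : ∀ s ∈ Icc t₀ T, ΦA s s = 1)
    (hΦt : ∀ s ∈ Icc t₀ T, ∀ t ∈ Icc t₀ T, ∀ i j,
      HasDerivAt (fun τ => ΦA τ s i j) ((-(A t * ΦA t s)) i j) t)
    (hΦs : ∀ t ∈ Icc t₀ T, ∀ s ∈ Icc t₀ T, ∀ i j,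
      HasDerivAt (fun σ => ΦA t σ i j) ((ΦA t s * A s) i j) s)
    (π : ℝ → Matrix (Fin n) (Fin n) ℝ)
    (hπ : ∀ t ∈ Icc t₀ T, ∀ i j, HasDerivAt (fun τ => π τ i j)
      ((π t * A t + (A t)ᵀ * π t - M t) i j) t)
    (hπT : π T = 0)
    (J₀ : Matrix (Fin n) (Fin n) ℝ)
    (hJ₀ : J₀.PosSemidef) (hJπ : IsUnit (J₀ + π t₀))
    (t : ℝ) (ht : t ∈ Icc t₀ T) (z : Fin n → ℝ)
    (ζ : ℝ → Fin n → ℝ)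
    (hζ : ∀ s, ζ s = (ΦA s t₀ * (J₀ + π t₀)⁻¹ * (ΦA t t₀)ᵀ) *ᵥ z) :
    ∀ y : ℝ → Fin n → ℝ,
      (∀ s ∈ Icc t₀ T, HasDerivAt y (-(A s *ᵥ y s)) s) →
      (ζ t₀) ⬝ᵥ (J₀ *ᵥ y t₀) + (∫ s in t₀..T, (M s *ᵥ ζ s) ⬝ᵥ y s)
        = (y t) ⬝ᵥ z := by
  intro y hy
  have h₀ : t₀ ∈ Icc t₀ T := left_mem_Icc.2 htT.le
  have hΦv (v : Fin n → ℝ) (s : ℝ) (hs : s ∈ Icc t₀ T) :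
      HasDerivAt (fun τ => ΦA τ t₀ *ᵥ v) (-(A s *ᵥ (ΦA s t₀ *ᵥ v))) s := by
    convert hasDerivAt_mulVec (hΦt t₀ h₀ s hs) (hasDerivAt_const s v) using 1
    simp [neg_mulVec]
  have hyt : ΦA t t₀ *ᵥ y t₀ = y t := by
    have h : ∀ i, (ΦA t t₀ *ᵥ y t₀) i = (ΦA t t *ᵥ y t) i := fun i =>
      eq_of_hasDerivAt_zero (f := fun σ => (ΦA t σ *ᵥ y σ) i) ht.1 fun s hs => by
        have hs' : s ∈ Icc t₀ T := ⟨hs.1, hs.2.trans ht.2⟩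
        have hd := hasDerivAt_pi.1 (hasDerivAt_mulVec (hΦs t ht s hs') (hy s hs')) i
        simpa [mulVec_neg] using hd
    rw [hΦ0 t ht, one_mulVec] at h
    exact funext h
  have hπsymm : (π t₀)ᵀ = π t₀ := by
    have hd (s : ℝ) (hs : s ∈ Icc t₀ T) (i j : Fin n) :
        HasDerivAt (fun τ => (π τ - (π τ)ᵀ) i j)
          (((π s - (π s)ᵀ) * A s + (A s)ᵀ * (π s - (π s)ᵀ) - 0) i j) s := by
      refine ((hπ s hs i j).sub (hπ s hs j i)).congr_deriv ?_
      have hMs : (M s)ᵀ = M s := transpose_eq_of_posSemidef (hMpsd s hs)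
      rw [← transpose_apply (π s * A s + (A s)ᵀ * π s - M s) i j, ← Matrix.sub_apply]
      refine congr_fun (congr_fun ?_ i) j
      simp only [transpose_sub, transpose_add, transpose_mul, transpose_transpose, hMs,
        Matrix.sub_mul, Matrix.mul_sub]
      abel
    have h (u v : Fin n → ℝ) : u ⬝ᵥ ((π t₀ - (π t₀)ᵀ) *ᵥ v) = 0 := by
      have := eq_of_hasDerivAt_zero htT.le fun s hs => by
        simpa only [zero_mulVec, dotProduct_zero, neg_zero] using
          hasDerivAt_lyapunov_pairing (hd s hs) (hΦv u s hs) (hΦv v s hs)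
      simpa [hΦ0 t₀ h₀, hπT] using this
    have hzero : π t₀ - (π t₀)ᵀ = 0 := by
      ext i j
      simpa using h (Pi.single i 1) (Pi.single j 1)
    exact (sub_eq_zero.1 hzero).symm
  set w : Fin n → ℝ := (J₀ + π t₀)⁻¹ *ᵥ ((ΦA t t₀)ᵀ *ᵥ z) with hw
  have hζw : ζ = fun s => ΦA s t₀ *ᵥ w := by
    funext s
    rw [hζ, hw, mulVec_mulVec, mulVec_mulVec, Matrix.mul_assoc]
  have hζd (s : ℝ) (hs : s ∈ Icc t₀ T) : HasDerivAt ζ (-(A s *ᵥ ζ s)) s := by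
    rw [hζw]
    exact hΦv w s hs
  have hint : ∫ s in t₀..T, (M s *ᵥ ζ s) ⬝ᵥ y s = ζ t₀ ⬝ᵥ (π t₀ *ᵥ y t₀) := by
    have hd (s : ℝ) (hs : s ∈ uIcc t₀ T) :
        HasDerivAt (fun τ => -(ζ τ ⬝ᵥ (π τ *ᵥ y τ))) ((M s *ᵥ ζ s) ⬝ᵥ y s) s := by
      rw [uIcc_of_le htT.le] at hs
      have hMs : (M s)ᵀ = M s := transpose_eq_of_posSemidef (hMpsd s hs)
      refine (hasDerivAt_lyapunov_pairing (hπ s hs) (hζd s hs) (hy s hs)).neg.congr_deriv ?_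
      rw [neg_neg, dotProduct_mulVec, ← mulVec_transpose, hMs]
    have hc : ContinuousOn (fun s => (M s *ᵥ ζ s) ⬝ᵥ y s) (uIcc t₀ T) := by
      rw [uIcc_of_le htT.le]
      have hζc : ContinuousOn ζ (Icc t₀ T) :=
        fun s hs => (hζd s hs).continuousAt.continuousWithinAt
      have hyc : ContinuousOn y (Icc t₀ T) :=
        fun s hs => (hy s hs).continuousAt.continuousWithinAt
      rw [continuousOn_iff_continuous_domRestrict] at hM hζc hyc ⊢
      exact (hM.matrix_mulVec hζc).dotProduct hyc
    rw [intervalIntegral.integral_eq_sub_of_hasDerivAt hd hc.intervalIntegrable]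
    simp [hπT]
  have hJsymm : J₀ᵀ = J₀ := transpose_eq_of_posSemidef hJ₀
  have hζ₀ : ζ t₀ = w := by simp [hζw, hΦ0 t₀ h₀]
  have hw' : (J₀ + π t₀) *ᵥ w = (ΦA t t₀)ᵀ *ᵥ z := by
    rw [hw, mulVec_mulVec, Matrix.mul_nonsing_inv _ ((Matrix.isUnit_iff_isUnit_det _).1 hJπ),
      one_mulVec]
  rw [hint, hζ₀, ← dotProduct_add, ← add_mulVec, dotProduct_mulVec, ← mulVec_transpose,
    transpose_add, hJsymm, hπsymm, hw', mulVec_transpose, ← dotProduct_mulVec, hyt,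
    dotProduct_comm]
end

section
/- For every y₀ ∈ ℝⁿ and every τ ∈ [t₀,T]: ∫_τ^T Φ(t,τ)ᵀ·M(t)·Φ_A(t,t₀)·y₀ dt = P(τ)·Φ_A(τ,t₀)·y₀. -/
open MeasureTheory Matrix Set

theorem hasDerivAt_matrix_mul_apply_s12 {n : ℕ} {F G : ℝ → Matrix (Fin n) (Fin n) ℝ}
    {F' G' : Matrix (Fin n) (Fin n) ℝ} {t : ℝ}
    (hF : ∀ i j, HasDerivAt (fun r => F r i j) (F' i j) t)
    (hG : ∀ i j, HasDerivAt (fun r => G r i j) (G' i j) t) (i j : Fin n) :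
    HasDerivAt (fun r => (F r * G r) i j) ((F' * G t + F t * G') i j) t := by
  simp only [Matrix.add_apply, Matrix.mul_apply, ← Finset.sum_add_distrib]
  exact HasDerivAt.fun_sum fun k _ => (hF i k).mul (hG k j)

theorem continuousOn_of_hasDerivAt_apply {n : ℕ} {F F' : ℝ → Matrix (Fin n) (Fin n) ℝ} {s : Set ℝ}
    (hF : ∀ t ∈ s, ∀ i j, HasDerivAt (fun r => F r i j) (F' t i j) t) : ContinuousOn F s :=
  continuousOn_pi.2 fun i => continuousOn_pi.2 fun j t ht =>
    (hF t ht i j).continuousAt.continuousWithinAt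

/-- A solution of the Lyapunov equation `Q' = Q K + Kᵀ Q` that vanishes at the terminal time
vanishes identically, when `K` has an evolution family. -/
theorem eq_zero_of_lyapunov {n : ℕ} {t₀ T : ℝ} {Q K : ℝ → Matrix (Fin n) (Fin n) ℝ}
    (hQ : ∀ t ∈ Icc t₀ T, ∀ i j,
      HasDerivAt (fun r => Q r i j) ((Q t * K t + (K t)ᵀ * Q t) i j) t)
    (hQT : Q T = 0) {Φ : ℝ → ℝ → Matrix (Fin n) (Fin n) ℝ}
    (hΦ0 : ∀ s ∈ Icc t₀ T, Φ s s = 1)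
    (hΦt : ∀ s ∈ Icc t₀ T, ∀ t ∈ Icc t₀ T, ∀ i j,
      HasDerivAt (fun r => Φ r s i j) ((-(K t * Φ t s)) i j) t)
    {s : ℝ} (hs : s ∈ Icc t₀ T) : Q s = 0 := by
  have hconj : ∀ t ∈ Icc t₀ T, ∀ i j,
      HasDerivAt (fun r => ((Φ r s)ᵀ * (Q r * Φ r s)) i j) 0 t := by
    intro t ht i j
    have h := hasDerivAt_matrix_mul_apply_s12 (F := fun r => (Φ r s)ᵀ) (F' := (-(K t * Φ t s))ᵀ)
      (fun i j => hΦt s hs t ht j i)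
      (hasDerivAt_matrix_mul_apply_s12 (hQ t ht) (hΦt s hs t ht)) i j
    refine h.congr_deriv (congrFun₂ (g := (0 : Matrix (Fin n) (Fin n) ℝ)) ?_ i j)
    simp only [transpose_neg, transpose_mul, Matrix.mul_add, Matrix.add_mul, Matrix.mul_neg,
      Matrix.neg_mul, Matrix.mul_assoc]
    abel
  have hsub : Icc s T ⊆ Icc t₀ T := Icc_subset_Icc_left hs.1
  ext i j
  have h := constant_of_has_deriv_right_zero
    (fun t ht => (hconj t (hsub ht) i j).continuousAt.continuousWithinAt)
    (fun t ht => (hconj t (hsub (Ico_subset_Icc_self ht)) i j).hasDerivWithinAt)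
    T (right_mem_Icc.2 hs.2)
  simpa [hQT, hΦ0 s hs] using h.symm

/-- For every `y₀` and `τ ∈ [t₀,T]`,
`∫_τ^T Φ(t,τ)ᵀ M(t) Φ_A(t,t₀) y₀ dt = P(τ) Φ_A(τ,t₀) y₀`. -/
theorem stmt_12
    {n m : ℕ} {t₀ T : ℝ} (htT : t₀ < T)
    (A M : ℝ → Matrix (Fin n) (Fin n) ℝ)
    (B : ℝ → Matrix (Fin n) (Fin m) ℝ)
    (N : ℝ → Matrix (Fin m) (Fin m) ℝ)
    (hA : ContinuousOn A (Icc t₀ T)) (hM : ContinuousOn M (Icc t₀ T))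
    (hB : ContinuousOn B (Icc t₀ T)) (hN : ContinuousOn N (Icc t₀ T))
    (hMpsd : ∀ t ∈ Icc t₀ T, (M t).PosSemidef)
    (hNpd : ∀ t ∈ Icc t₀ T, (N t).PosDef)
    (P : ℝ → Matrix (Fin n) (Fin n) ℝ)
    (hP : ∀ t ∈ Icc t₀ T, ∀ i j, HasDerivAt (fun τ => P τ i j)
      ((P t * A t + (A t)ᵀ * P t + P t * B t * (N t)⁻¹ * (B t)ᵀ * P t - M t) i j) t)
    (hPT : P T = 0)
    (Φ : ℝ → ℝ → Matrix (Fin n) (Fin n) ℝ)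
    (hΦ0 : ∀ s ∈ Icc t₀ T, Φ s s = 1)
    (hΦt : ∀ s ∈ Icc t₀ T, ∀ t ∈ Icc t₀ T, ∀ i j,
      HasDerivAt (fun τ => Φ τ s i j)
        ((-((A t + B t * (N t)⁻¹ * (B t)ᵀ * P t) * Φ t s)) i j) t)
    (hΦs : ∀ t ∈ Icc t₀ T, ∀ s ∈ Icc t₀ T, ∀ i j,
      HasDerivAt (fun σ => Φ t σ i j)
        ((Φ t s * (A s + B s * (N s)⁻¹ * (B s)ᵀ * P s)) i j) s)
    (ΦA : ℝ → ℝ → Matrix (Fin n) (Fin n) ℝ)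
    (hΦA0 : ∀ s ∈ Icc t₀ T, ΦA s s = 1)
    (hΦAt : ∀ s ∈ Icc t₀ T, ∀ t ∈ Icc t₀ T, ∀ i j,
      HasDerivAt (fun τ => ΦA τ s i j) ((-(A t * ΦA t s)) i j) t)
    (hΦAs : ∀ t ∈ Icc t₀ T, ∀ s ∈ Icc t₀ T, ∀ i j,
      HasDerivAt (fun σ => ΦA t σ i j) ((ΦA t s * A s) i j) s) :
    ∀ (y₀ : Fin n → ℝ), ∀ τ ∈ Icc t₀ T,
      (∫ t in τ..T, (Φ t τ)ᵀ *ᵥ (M t *ᵥ (ΦA t t₀ *ᵥ y₀)))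
        = P τ *ᵥ (ΦA τ t₀ *ᵥ y₀) := by
  have hMT : ∀ t ∈ Icc t₀ T, (M t)ᵀ = M t := fun t ht => by
    simpa using (hMpsd t ht).isHermitian.eq
  have hNT : ∀ t ∈ Icc t₀ T, ((N t)⁻¹)ᵀ = (N t)⁻¹ := fun t ht => by
    simpa using (hNpd t ht).isHermitian.inv.eq
  have hsymm : ∀ t ∈ Icc t₀ T, (P t)ᵀ = P t := by
    intro t ht
    refine (sub_eq_zero.1 (eq_zero_of_lyapunov (Q := fun r => P r - (P r)ᵀ)
      (fun r hr i j => ?_) (by simp [hPT]) hΦ0 hΦt ht)).symm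
    let R := P r * A r + (A r)ᵀ * P r + P r * B r * (N r)⁻¹ * (B r)ᵀ * P r - M r
    refine ((hP r hr i j).fun_sub (hP r hr j i)).congr_deriv (congrFun₂ (f := R - Rᵀ) ?_ i j)
    simp only [R, transpose_add, transpose_sub, transpose_mul, transpose_transpose, hMT r hr,
      hNT r hr, Matrix.mul_add, Matrix.add_mul, Matrix.mul_sub, Matrix.sub_mul, Matrix.mul_assoc]
    abel
  intro y₀ τ hτ
  have ht₀ : t₀ ∈ Icc t₀ T := left_mem_Icc.2 htT.le
  have hsub : uIcc τ T ⊆ Icc t₀ T := by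
    rw [uIcc_of_le hτ.2]
    exact Icc_subset_Icc_left hτ.1
  have hderiv : ∀ t ∈ uIcc τ T,
      HasDerivAt (fun r => -(((Φ r τ)ᵀ * (P r * ΦA r t₀)) *ᵥ y₀))
        ((Φ t τ)ᵀ *ᵥ (M t *ᵥ (ΦA t t₀ *ᵥ y₀))) t := by
    intro t ht
    have h := hasDerivAt_matrix_mul_apply_s12 (F := fun r => (Φ r τ)ᵀ)
      (F' := (-((A t + B t * (N t)⁻¹ * (B t)ᵀ * P t) * Φ t τ))ᵀ)
      (fun i j => hΦt τ hτ t (hsub ht) j i)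
      (hasDerivAt_matrix_mul_apply_s12 (hP t (hsub ht)) (hΦAt t₀ ht₀ t (hsub ht)))
    have hW : (-((A t + B t * (N t)⁻¹ * (B t)ᵀ * P t) * Φ t τ))ᵀ * (P t * ΦA t t₀) +
        (Φ t τ)ᵀ * ((P t * A t + (A t)ᵀ * P t + P t * B t * (N t)⁻¹ * (B t)ᵀ * P t - M t) *
          ΦA t t₀ + P t * -(A t * ΦA t t₀)) = -((Φ t τ)ᵀ * (M t * ΦA t t₀)) := by
      simp only [transpose_neg, transpose_add, transpose_mul, transpose_transpose,
        hNT t (hsub ht), hsymm t (hsub ht), Matrix.mul_add, Matrix.add_mul, Matrix.mul_sub,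
        Matrix.sub_mul, Matrix.mul_neg, Matrix.neg_mul, Matrix.mul_assoc]
      abel
    rw [hW] at h
    refine hasDerivAt_pi.2 fun i => ?_
    refine (HasDerivAt.fun_sum (u := Finset.univ)
      fun j _ => (h i j).mul_const (y₀ j)).fun_neg.congr_deriv ?_
    rw [Matrix.mulVec_mulVec, Matrix.mulVec_mulVec, Matrix.mul_assoc]
    simp only [Matrix.mulVec, dotProduct, Matrix.neg_apply, neg_mul,
      Finset.sum_neg_distrib, neg_neg]
  have hint : IntervalIntegrable (fun t => (Φ t τ)ᵀ *ᵥ (M t *ᵥ (ΦA t t₀ *ᵥ y₀))) volume τ T := by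
    refine ContinuousOn.intervalIntegrable (ContinuousOn.mono ?_ hsub)
    have hΦc := continuousOn_of_hasDerivAt_apply (hΦt τ hτ)
    have hΦAc := continuousOn_of_hasDerivAt_apply (hΦAt t₀ ht₀)
    rw [continuousOn_iff_continuous_domRestrict] at *
    exact hΦc.matrix_transpose.matrix_mulVec
      (hM.matrix_mulVec (hΦAc.matrix_mulVec continuous_const))
  rw [intervalIntegral.integral_eq_sub_of_hasDerivAt hderiv hint]
  simp [hPT, hΦ0 τ hτ, Matrix.mulVec_mulVec]
end

section
/- Let X and H be real Hilbert spaces, N ∈ ℕ, and E₁,…,E_N : X → H continuous linear maps. Let L : Hᴺ × ℝ → ℝ ∪ {+∞} be such that for every fixed z ∈ Hᴺ the map ξ ↦ L(z,ξ) is strictly monotone increasing on [0,∞). If x̂ minimizes the functional x ↦ L((E₁x,…,E_N x), ‖x‖²) over X, then x̂ belongs to the topological closure of the linear span of ⋃_{n=1}^N { Eₙ*(z) : z ∈ H }, where Eₙ* denotes the Hilbert adjoint of Eₙ. -/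
open Set

/-- Representer theorem: if `x₀` minimizes
`x ↦ L((E₁x,…,E_Nx), ‖x‖²)` where each `L(z,·)` is strictly increasing on
`[0,∞)`, then `x₀` lies in the closed linear span of the representers
`Eₙ*(z)`, `z ∈ H`, `n = 1,…,N`. -/
theorem stmt_14
    {X H : Type*} [NormedAddCommGroup X] [InnerProductSpace ℝ X] [CompleteSpace X]
    [NormedAddCommGroup H] [InnerProductSpace ℝ H] [CompleteSpace H]
    (N : ℕ) (E : Fin N → (X →L[ℝ] H))
    (L : (Fin N → H) × ℝ → WithTop ℝ)
    (hL : ∀ z : Fin N → H, StrictMonoOn (fun ξ => L (z, ξ)) (Ici (0 : ℝ)))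
    (x₀ : X)
    (hmin : ∀ x : X, L (fun n => E n x₀, ‖x₀‖ ^ 2) ≤ L (fun n => E n x, ‖x‖ ^ 2)) :
    x₀ ∈ closure (Submodule.span ℝ
      (⋃ n : Fin N, Set.range (ContinuousLinearMap.adjoint (E n))) : Set X) := by
  set S := Submodule.span ℝ
    (⋃ n : Fin N, Set.range (ContinuousLinearMap.adjoint (E n)))
  have : CompleteSpace S.topologicalClosure :=
    S.isClosed_topologicalClosure.completeSpace_coe
  set p := S.topologicalClosure.starProjection x₀
  have hpmem : p ∈ S.topologicalClosure := Submodule.starProjection_apply_mem _ _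
  have horth : x₀ - p ∈ S.topologicalClosureᗮ := Submodule.sub_starProjection_mem_orthogonal _
  have hE (n : Fin N) : E n p = E n x₀ := by
    refine (ext_inner_left ℝ fun z => ?_).symm
    have hz : ContinuousLinearMap.adjoint (E n) z ∈ S.topologicalClosure :=
      S.le_topologicalClosure (Submodule.subset_span (mem_iUnion.2 ⟨n, z, rfl⟩))
    have h := Submodule.inner_right_of_mem_orthogonal hz horth
    rwa [ContinuousLinearMap.adjoint_inner_left, map_sub, inner_sub_right, sub_eq_zero] at h
  have hnorm : ‖x₀‖ ^ 2 = ‖p‖ ^ 2 + ‖x₀ - p‖ ^ 2 := by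
    have h := norm_add_sq_eq_norm_sq_add_norm_sq_real
      (Submodule.inner_right_of_mem_orthogonal hpmem horth)
    rw [add_sub_cancel] at h
    simpa only [sq] using h
  have hle : ‖x₀‖ ^ 2 ≤ ‖p‖ ^ 2 := by
    have h := hmin p
    simp only [hE] at h
    exact ((hL _).le_iff_le (mem_Ici.2 (sq_nonneg _)) (mem_Ici.2 (sq_nonneg _))).1 h
  have hzero : x₀ - p = 0 := by
    rw [← norm_eq_zero, ← sq_eq_zero_iff]
    linarith [sq_nonneg ‖x₀ - p‖]
  rw [← Submodule.topologicalClosure_coe, sub_eq_zero.1 hzero]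
  exact hpmem
end

section
/- Let U and H be real Hilbert spaces, B : U → H a continuous linear map, and N : U → U a continuous self-adjoint linear operator with ⟪N u, u⟫ ≥ ν·‖u‖² for all u ∈ U, for some ν > 0. Suppose u₀ ∈ U satisfies N u₀ ∈ range(B*), where B* is the Hilbert adjoint of B. Then for every u ∈ U with B u = B u₀ one has ⟪N u₀, u₀⟫ ≤ ⟪N u, u⟫, with equality if and only if u = u₀; that is, u₀ is the unique minimal-cost control among all controls producing the same input B u₀. -/
open RealInnerProductSpace

/-- Minimal-cost control: if `N` is self-adjoint and coercive
and `N u₀ ∈ range B*`, then `u₀` uniquely minimizes the cost `⟪N u, u⟫` among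
all controls `u` with `B u = B u₀`. -/
theorem stmt_16
    {U H : Type*} [NormedAddCommGroup U] [InnerProductSpace ℝ U] [CompleteSpace U]
    [NormedAddCommGroup H] [InnerProductSpace ℝ H] [CompleteSpace H]
    (B : U →L[ℝ] H) (N : U →L[ℝ] U)
    (hNsa : ∀ u v : U, ⟪N u, v⟫ = ⟪u, N v⟫)
    (ν : ℝ) (hν : 0 < ν)
    (hNpos : ∀ u : U, ν * ‖u‖ ^ 2 ≤ ⟪N u, u⟫)
    (u₀ : U) (hu₀ : N u₀ ∈ Set.range (ContinuousLinearMap.adjoint B)) :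
    ∀ u : U, B u = B u₀ →
      ⟪N u₀, u₀⟫ ≤ ⟪N u, u⟫ ∧ (⟪N u₀, u₀⟫ = ⟪N u, u⟫ ↔ u = u₀) := by
  intro u hu
  obtain ⟨p, hp⟩ := hu₀
  have horth : ⟪N u₀, u - u₀⟫ = 0 := by
    rw [← hp, ContinuousLinearMap.adjoint_inner_left, map_sub, hu, sub_self, inner_zero_right]
  have hcost : ⟪N u, u⟫ = ⟪N u₀, u₀⟫ + ⟪N (u - u₀), u - u₀⟫ := by
    have hsymm : ⟪N u, u₀⟫ = ⟪N u₀, u⟫ := by rw [hNsa, real_inner_comm]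
    rw [inner_sub_right] at horth
    simp only [map_sub, inner_sub_left, inner_sub_right]
    linarith
  have hcoer := hNpos (u - u₀)
  have hnonneg : 0 ≤ ν * ‖u - u₀‖ ^ 2 := by positivity
  refine ⟨by linarith, fun heq => ?_, fun h => by rw [h]⟩
  have hzero : ν * ‖u - u₀‖ ^ 2 = 0 := by linarith
  simpa [hν.ne', sub_eq_zero] using hzero
end
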